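/- For every word ω over {1,2,3}, one has E(ω1, ω2) = (47/18)·E(ω3) = (47/120)·E(ω), and E(ω1) = E(ω2) = (1/12)·E(ω3) = (1/80)·E(ω). -/

import Mathlib

open MeasureTheory Real Set
open scoped ENNReal NNReal

/-- The three contractive similarities generating the nonhomogeneous R-triangle.
Letters 1,2,3 of the paper correspond to `0,1,2 : Fin 3`. -/
noncomputable def Smap : Fin 3 → ℝ × ℝ → ℝ × ℝ :=
  ![fun x => (x.1 / 4, x.2 / 4),
    fun x => (x.1 / 4 + 3 / 4, x.2 / 4),
    fun x => (x.1 / 2 + 1 / 4, x.2 / 2 + Real.sqrt 3 / 4)]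

/-- `Sw ω = S_{ω₁} ∘ ⋯ ∘ S_{ω_k}` for a word `ω = ω₁⋯ω_k`. -/
noncomputable def Sw (ω : List (Fin 3)) : ℝ × ℝ → ℝ × ℝ :=
  (ω.map Smap).foldr (· ∘ ·) id

/-- The probability weights `p₁ = p₂ = 1/5`, `p₃ = 3/5`. -/
noncomputable def pr : Fin 3 → ℝ := ![1/5, 1/5, 3/5]

/-- The similarity ratios `s₁ = s₂ = 1/4`, `s₃ = 1/2`. -/
noncomputable def sr : Fin 3 → ℝ := ![1/4, 1/4, 1/2]

/-- `p_ω = p_{ω₁}⋯p_{ω_k}`. -/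
noncomputable def pw (ω : List (Fin 3)) : ℝ := (ω.map pr).prod

/-- `s_ω = s_{ω₁}⋯s_{ω_k}`. -/
noncomputable def sw (ω : List (Fin 3)) : ℝ := (ω.map sr).prod

/-- `P` is the nonhomogeneous R-measure:
`P = (1/5)·P∘S₁⁻¹ + (1/5)·P∘S₂⁻¹ + (3/5)·P∘S₃⁻¹`. -/
def IsRMeasure (P : Measure (ℝ × ℝ)) : Prop :=
  P = (1/5 : ℝ≥0∞) • P.map (Smap 0) + (1/5 : ℝ≥0∞) • P.map (Smap 1)
        + (3/5 : ℝ≥0∞) • P.map (Smap 2)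

/-- The closed equilateral triangle with vertices (0,0), (1,0), (1/2, √3/2). -/
noncomputable def Δtri : Set (ℝ × ℝ) :=
  convexHull ℝ ({(0, 0), (1, 0), (1/2, Real.sqrt 3 / 2)} : Set (ℝ × ℝ))

/-- Squared Euclidean distance on ℝ². -/
def sqDist (x a : ℝ × ℝ) : ℝ := (x.1 - a.1) ^ 2 + (x.2 - a.2) ^ 2

/-- `a(ω) = S_ω(1/2, √3/4)`. -/
noncomputable def aw (ω : List (Fin 3)) : ℝ × ℝ := Sw ω (1/2, Real.sqrt 3 / 4)

/-- `a(ω1, ω2) = (S_{ω1}(1/2, √3/4) + S_{ω2}(1/2, √3/4))/2`. -/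
noncomputable def a12 (ω : List (Fin 3)) : ℝ × ℝ :=
  (1/2 : ℝ) • (aw (ω ++ [0]) + aw (ω ++ [1]))

/-- `E(ω) = ∫_{Δ_ω} ‖x − a(ω)‖² dP`. -/
noncomputable def Ew (P : Measure (ℝ × ℝ)) (ω : List (Fin 3)) : ℝ :=
  ∫ x in Sw ω '' Δtri, sqDist x (aw ω) ∂P

/-- `E(ω1, ω2) = ∫_{Δ_{ω1} ∪ Δ_{ω2}} ‖x − a(ω1, ω2)‖² dP`. -/
noncomputable def E12 (P : Measure (ℝ × ℝ)) (ω : List (Fin 3)) : ℝ :=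
  ∫ x in (Sw (ω ++ [0]) '' Δtri) ∪ (Sw (ω ++ [1]) '' Δtri), sqDist x (a12 ω) ∂P

lemma Δtri_eq : Δtri =
    {x : ℝ × ℝ | 0 ≤ x.2 ∧ 0 ≤ √3 * x.1 - x.2 ∧ 0 ≤ √3 * (1 - x.1) - x.2} := by
  have h3 : (0 : ℝ) < √3 := by positivity
  apply Subset.antisymm
  · apply convexHull_min
    · rintro x (rfl | rfl | rfl) <;> refine ⟨?_, ?_, ?_⟩ <;> norm_num <;> linarith
    · rintro x ⟨h1, h2, h4⟩ y ⟨k1, k2, k4⟩ a b ha hb hab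
      obtain rfl : b = 1 - a := by linarith
      simp only [mem_ofPred_eq, Prod.fst_add, Prod.snd_add, Prod.smul_fst, Prod.smul_snd,
        smul_eq_mul]
      refine ⟨by positivity, ?_, ?_⟩
      · linarith [mul_nonneg ha h2, mul_nonneg hb k2]
      · linarith [mul_nonneg ha h4, mul_nonneg hb k4]
  · rintro ⟨x, y⟩ ⟨h1, h2, h4⟩
    simp only at h1 h2 h4
    have hy : y / √3 * √3 = y := div_mul_cancel₀ y h3.ne'
    have hy0 : 0 ≤ y / √3 := by positivity
    have h2' : 0 ≤ x - y / √3 := by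
      by_contra! h
      nlinarith
    have h4' : 0 ≤ 1 - x - y / √3 := by
      by_contra! h
      nlinarith
    have hc : Convex ℝ Δtri := convex_convexHull ℝ _
    have m1 : ((0, 0) : ℝ × ℝ) ∈ Δtri := subset_convexHull ℝ _ (by simp)
    have m2 : ((1, 0) : ℝ × ℝ) ∈ Δtri := subset_convexHull ℝ _ (by simp)
    have m3 : ((1 / 2, √3 / 2) : ℝ × ℝ) ∈ Δtri := subset_convexHull ℝ _ (by simp)
    have key := hc.sum_mem (t := Finset.univ) (w := ![1 - x - y / √3, x - y / √3, 2 * (y / √3)])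
      (z := ![((0, 0) : ℝ × ℝ), (1, 0), (1 / 2, √3 / 2)])
      (by intro i _; fin_cases i <;> simp <;> linarith)
      (by simp [Fin.sum_univ_three]; ring)
      (by intro i _; fin_cases i <;> simp [m1, m2]; simpa using m3)
    convert key using 1
    simp only [Fin.sum_univ_three]
    ext
    · simp
      ring
    · simp
      linarith

lemma isCompact_Δtri : IsCompact Δtri :=
  (Set.toFinite _).isCompact_convexHull ℝ

lemma continuous_Smap (i : Fin 3) : Continuous (Smap i) := by
  fin_cases i <;> simp only [Smap] <;> dsimp <;> fun_prop

lemma injective_Smap (i : Fin 3) : Function.Injective (Smap i) := by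
  rintro ⟨a, b⟩ ⟨c, d⟩ h
  fin_cases i <;> simp [Smap] at h <;> ext <;> simp [h]

lemma Smap_mem_Δtri (i : Fin 3) {x : ℝ × ℝ} (hx : x ∈ Δtri) : Smap i x ∈ Δtri := by
  have h3 : (0 : ℝ) < √3 := by positivity
  rw [Δtri_eq] at hx ⊢
  obtain ⟨h1, h2, h4⟩ := hx
  fin_cases i <;> simp [Smap] <;> refine ⟨?_, ?_, ?_⟩ <;> linarith

lemma Smap_image_subset (i : Fin 3) {A : Set (ℝ × ℝ)} (hA : A ⊆ Δtri) :
    Smap i '' A ⊆ Δtri := by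
  rintro _ ⟨x, hx, rfl⟩
  exact Smap_mem_Δtri i (hA hx)

lemma Smap_ne {i j : Fin 3} (hij : i ≠ j) {x y : ℝ × ℝ} (hx : x ∈ Δtri) (hy : y ∈ Δtri) :
    Smap i x ≠ Smap j y := by
  have h3 : (0 : ℝ) < √3 := by positivity
  rw [Δtri_eq] at hx hy
  obtain ⟨h1, h2, h4⟩ := hx
  obtain ⟨k1, k2, k4⟩ := hy
  intro h
  have e1 := congrArg Prod.fst h
  have e2 := congrArg Prod.snd h
  have e3 := congrArg (√3 * ·) e1
  fin_cases i <;> fin_cases j <;> simp [Smap] at hij e1 e2 e3 <;> first | linarith | nlinarith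

lemma measurableEmbedding_Smap (i : Fin 3) : MeasurableEmbedding (Smap i) :=
  (continuous_Smap i).measurableEmbedding (injective_Smap i)

lemma pr_nonneg (i : Fin 3) : 0 ≤ pr i := by
  fin_cases i <;> norm_num [pr]

lemma sqDist_Smap (i : Fin 3) (x b : ℝ × ℝ) :
    sqDist (Smap i x) (Smap i b) = sr i ^ 2 * sqDist x b := by
  fin_cases i <;> simp [Smap, sr, sqDist] <;> ring

@[fun_prop]
lemma continuous_sqDist (b : ℝ × ℝ) : Continuous (fun x => sqDist x b) := by
  unfold sqDist
  fun_prop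

namespace IsRMeasure

variable {P : Measure (ℝ × ℝ)}

lemma eq_sum (hP : IsRMeasure P) : P = ∑ i, ENNReal.ofReal (pr i) • P.map (Smap i) := by
  have h5 : ENNReal.ofReal (1 / 5) = 1 / 5 := by
    rw [ENNReal.ofReal_div_of_pos (by norm_num)]; simp
  have h35 : ENNReal.ofReal (3 / 5) = 3 / 5 := by
    rw [ENNReal.ofReal_div_of_pos (by norm_num)]; simp
  rw [Fin.sum_univ_three]
  simp only [pr, Matrix.cons_val_zero, Matrix.cons_val_one, Matrix.cons_val]
  rw [h5, h35]
  exact hP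

lemma integral_eq (hP : IsRMeasure P) {F : ℝ × ℝ → ℝ}
    (hi : ∀ i, Integrable (F ∘ Smap i) P) :
    ∫ x, F x ∂P = ∑ i, pr i * ∫ x, F (Smap i x) ∂P := by
  conv_lhs => rw [hP.eq_sum]
  rw [integral_finsetSum_measure]
  · refine Finset.sum_congr rfl fun i _ => ?_
    rw [integral_smul_measure, (measurableEmbedding_Smap i).integral_map,
      ENNReal.toReal_ofReal (pr_nonneg i), smul_eq_mul]
  · intro i _
    exact ((measurableEmbedding_Smap i).integrable_map_iff.2 (hi i)).smul_measure
      ENNReal.ofReal_ne_top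

lemma ae_nonneg [IsProbabilityMeasure P] (hP : IsRMeasure P) {f : ℝ × ℝ → ℝ} (hf : Continuous f)
    (h : ∀ i x, min (f x) 0 / 2 ≤ f (Smap i x)) : ∀ᵐ x ∂P, 0 ≤ f x := by
  set g : ℝ × ℝ → ℝ := fun x => max (-f x) 0 with hg
  have hgc : Continuous g := by fun_prop
  have hg0 : ∀ x, 0 ≤ g x := fun x => le_max_right _ _
  have hgS : ∀ i x, g (Smap i x) ≤ g x / 2 := by
    intro i x
    have := h i x
    simp only [hg]
    rcases le_total (f x) 0 with hx | hx
    · rw [min_eq_left hx] at this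
      rw [max_eq_left (by linarith : 0 ≤ -f x)]
      exact max_le (by linarith) (by linarith)
    · rw [min_eq_right hx] at this
      rw [max_eq_right (by linarith : -f x ≤ 0)]
      exact max_le (by linarith) (by linarith)
  have hint : ∀ k : ℝ × ℝ → ℝ, Continuous k → Integrable (fun x => arctan (k x)) P := by
    intro k hk
    refine Integrable.of_bound (by fun_prop) (π / 2) (.of_forall fun x => ?_)
    rw [Real.norm_eq_abs, abs_le]
    exact ⟨(neg_pi_div_two_lt_arctan _).le, (arctan_lt_pi_div_two _).le⟩
  have h2 : Integrable (fun x => arctan (g x / 2)) P := hint _ (by fun_prop)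
  have h1 : Integrable (fun x => arctan (g x)) P := hint _ hgc
  have hle : ∫ x, arctan (g x) ∂P ≤ ∫ x, arctan (g x / 2) ∂P := by
    have hS : ∀ i, Integrable (fun x => arctan (g (Smap i x))) P := fun i =>
      hint _ (hgc.comp (continuous_Smap i))
    rw [hP.integral_eq (F := fun x => arctan (g x)) hS]
    have : ∀ i, ∫ x, arctan (g (Smap i x)) ∂P ≤ ∫ x, arctan (g x / 2) ∂P := fun i =>
      integral_mono (hS i) h2 fun x => arctan_strictMono.monotone (hgS i x)
    rw [Fin.sum_univ_three]
    have e0 := this 0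
    have e1 := this 1
    have e2 := this 2
    simp only [pr, Matrix.cons_val_zero, Matrix.cons_val_one, Matrix.cons_val]
    linarith
  have hnn : ∀ x, 0 ≤ arctan (g x) - arctan (g x / 2) := fun x =>
    sub_nonneg.2 (arctan_strictMono.monotone (by linarith [hg0 x]))
  have hz : ∫ x, (arctan (g x) - arctan (g x / 2)) ∂P = 0 := by
    apply le_antisymm
    · rw [integral_sub h1 h2]; linarith
    · exact integral_nonneg hnn
  rw [integral_eq_zero_iff_of_nonneg hnn (h1.sub h2)] at hz
  filter_upwards [hz] with x hx
  have : g x = g x / 2 := arctan_injective (sub_eq_zero.1 hx)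
  have h0 : g x = 0 := by linarith
  linarith [le_max_left (-f x) 0, show max (-f x) 0 = 0 from h0]

lemma ae_mem_Δtri [IsProbabilityMeasure P] (hP : IsRMeasure P) : ∀ᵐ x ∂P, x ∈ Δtri := by
  have h3 : (0 : ℝ) < √3 := by positivity
  have e1 : ∀ᵐ x ∂P, 0 ≤ x.2 := by
    refine hP.ae_nonneg (by fun_prop) fun i x => ?_
    have := min_le_left x.2 0
    have := min_le_right x.2 0
    fin_cases i <;> simp [Smap] <;> linarith
  have e2 : ∀ᵐ x ∂P, 0 ≤ √3 * x.1 - x.2 := by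
    refine hP.ae_nonneg (by fun_prop) fun i x => ?_
    have := min_le_left (√3 * x.1 - x.2) 0
    have := min_le_right (√3 * x.1 - x.2) 0
    fin_cases i <;> simp only [Smap] <;> simp <;> linarith
  have e4 : ∀ᵐ x ∂P, 0 ≤ √3 * (1 - x.1) - x.2 := by
    refine hP.ae_nonneg (by fun_prop) fun i x => ?_
    have := min_le_left (√3 * (1 - x.1) - x.2) 0
    have := min_le_right (√3 * (1 - x.1) - x.2) 0
    fin_cases i <;> simp only [Smap] <;> simp <;> linarith
  rw [Δtri_eq]
  filter_upwards [e1, e2, e4] with x h1 h2 h4 using ⟨h1, h2, h4⟩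

lemma restrict_Δtri [IsProbabilityMeasure P] (hP : IsRMeasure P) : P.restrict Δtri = P :=
  Measure.restrict_eq_self_of_ae_mem hP.ae_mem_Δtri

lemma integrable [IsProbabilityMeasure P] (hP : IsRMeasure P) {F : ℝ × ℝ → ℝ}
    (hF : Continuous F) : Integrable F P := by
  rw [← hP.restrict_Δtri]
  exact hF.continuousOn.integrableOn_compact isCompact_Δtri

lemma restrict_image [IsProbabilityMeasure P] (hP : IsRMeasure P) (i : Fin 3)
    {A : Set (ℝ × ℝ)} (hA : A ⊆ Δtri) (hAm : MeasurableSet A) :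
    P.restrict (Smap i '' A) = ENNReal.ofReal (pr i) • (P.restrict A).map (Smap i) := by
  have hm : MeasurableSet (Smap i '' A) := (measurableEmbedding_Smap i).measurableSet_image.2 hAm
  conv_lhs => rw [hP.eq_sum]
  rw [← Measure.restrictₗ_apply, map_sum, Finset.sum_eq_single i]
  all_goals simp only [Measure.restrictₗ_apply]
  · rw [Measure.restrict_smul, Measure.restrict_map (continuous_Smap i).measurable hm,
      preimage_image_eq _ (injective_Smap i)]
  · intro j _ hj
    rw [Measure.restrict_smul, Measure.restrict_map (continuous_Smap j).measurable hm]
    have : P.restrict (Smap j ⁻¹' (Smap i '' A)) = 0 := by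
      rw [Measure.restrict_eq_zero, measure_eq_zero_iff_ae_notMem]
      filter_upwards [hP.ae_mem_Δtri] with x hx
      rintro ⟨y, hy, hyx⟩
      exact Smap_ne hj hx (hA hy) hyx.symm
    simp [this]
  · simp

lemma setIntegral_image [IsProbabilityMeasure P] (hP : IsRMeasure P) (i : Fin 3)
    {A : Set (ℝ × ℝ)} (hA : A ⊆ Δtri) (hAm : MeasurableSet A) (F : ℝ × ℝ → ℝ) :
    ∫ x in Smap i '' A, F x ∂P = pr i * ∫ x in A, F (Smap i x) ∂P := by
  rw [hP.restrict_image i hA hAm, integral_smul_measure,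
    (measurableEmbedding_Smap i).integral_map, ENNReal.toReal_ofReal (pr_nonneg i), smul_eq_mul]

lemma setIntegral_sqDist_image [IsProbabilityMeasure P] (hP : IsRMeasure P) (i : Fin 3)
    {A : Set (ℝ × ℝ)} (hA : A ⊆ Δtri) (hAm : MeasurableSet A) (b : ℝ × ℝ) :
    ∫ x in Smap i '' A, sqDist x (Smap i b) ∂P
      = pr i * sr i ^ 2 * ∫ x in A, sqDist x b ∂P := by
  rw [hP.setIntegral_image i hA hAm]
  simp only [sqDist_Smap]
  rw [integral_const_mul, mul_assoc]

end IsRMeasure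

lemma Sw_cons (i : Fin 3) (ω : List (Fin 3)) : Sw (i :: ω) = Smap i ∘ Sw ω := rfl

lemma Sw_concat (ω : List (Fin 3)) (i : Fin 3) : Sw (ω ++ [i]) = Sw ω ∘ Smap i := by
  induction ω with
  | nil => rfl
  | cons j ω ih => rw [List.cons_append, Sw_cons, ih, Sw_cons]; rfl

lemma Smap_midpoint (i : Fin 3) (x y : ℝ × ℝ) :
    Smap i ((1 / 2 : ℝ) • (x + y)) = (1 / 2 : ℝ) • (Smap i x + Smap i y) := by
  fin_cases i <;> ext <;> simp [Smap] <;> ring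

lemma Sw_midpoint (ω : List (Fin 3)) (x y : ℝ × ℝ) :
    Sw ω ((1 / 2 : ℝ) • (x + y)) = (1 / 2 : ℝ) • (Sw ω x + Sw ω y) := by
  induction ω with
  | nil => rfl
  | cons i ω ih => simp only [Sw_cons, Function.comp_apply, ih, Smap_midpoint]

lemma Sw_image_subset (ω : List (Fin 3)) {A : Set (ℝ × ℝ)} (hA : A ⊆ Δtri) :
    Sw ω '' A ⊆ Δtri := by
  induction ω with
  | nil => simpa [Sw] using hA
  | cons i ω ih =>
    rw [Sw_cons, image_comp]
    exact Smap_image_subset i ih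

lemma measurableSet_Sw_image (ω : List (Fin 3)) {A : Set (ℝ × ℝ)} (hA : MeasurableSet A) :
    MeasurableSet (Sw ω '' A) := by
  induction ω with
  | nil => simpa [Sw] using hA
  | cons i ω ih =>
    rw [Sw_cons, image_comp]
    exact (measurableEmbedding_Smap i).measurableSet_image.2 ih

namespace IsRMeasure

variable {P : Measure (ℝ × ℝ)} [IsProbabilityMeasure P]

lemma setIntegral_sqDist_Sw_image (hP : IsRMeasure P) (ω : List (Fin 3)) {A : Set (ℝ × ℝ)}
    (hA : A ⊆ Δtri) (hAm : MeasurableSet A) (b : ℝ × ℝ) :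
    ∫ x in Sw ω '' A, sqDist x (Sw ω b) ∂P = pw ω * sw ω ^ 2 * ∫ x in A, sqDist x b ∂P := by
  induction ω with
  | nil => simp [Sw, pw, sw]
  | cons i ω ih =>
    rw [Sw_cons, image_comp, Function.comp_apply,
      hP.setIntegral_sqDist_image i (Sw_image_subset ω hA) (measurableSet_Sw_image ω hAm), ih]
    simp only [pw, sw, List.map_cons, List.prod_cons]
    ring

lemma Ew_eq (hP : IsRMeasure P) (ω : List (Fin 3)) :
    Ew P ω = pw ω * sw ω ^ 2 * ∫ x, sqDist x (1 / 2, √3 / 4) ∂P := by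
  rw [Ew, aw, hP.setIntegral_sqDist_Sw_image ω Subset.rfl isCompact_Δtri.measurableSet,
    hP.restrict_Δtri]

lemma Ew_concat (hP : IsRMeasure P) (ω : List (Fin 3)) (i : Fin 3) :
    Ew P (ω ++ [i]) = pr i * sr i ^ 2 * Ew P ω := by
  rw [hP.Ew_eq, hP.Ew_eq]
  simp only [pw, sw, List.map_append, List.prod_append, List.map_cons, List.map_nil,
    List.prod_cons, List.prod_nil]
  ring

lemma integral_fst (hP : IsRMeasure P) : ∫ x, x.1 ∂P = 1 / 2 := by
  have hi : Integrable (fun x : ℝ × ℝ => x.1) P := hP.integrable (by fun_prop)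
  have h := hP.integral_eq (F := Prod.fst) fun i =>
    hP.integrable (continuous_fst.comp (continuous_Smap i))
  simp only [Fin.sum_univ_three, Smap, pr, Matrix.cons_val_zero, Matrix.cons_val_one,
    Matrix.cons_val] at h
  rw [integral_add (hi.div_const 4) (integrable_const _),
    integral_add (hi.div_const 2) (integrable_const _)] at h
  simp only [integral_div, integral_const, probReal_univ, one_smul] at h
  linarith

lemma integral_snd (hP : IsRMeasure P) : ∫ x, x.2 ∂P = √3 / 4 := by
  have hi : Integrable (fun x : ℝ × ℝ => x.2) P := hP.integrable (by fun_prop)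
  have h := hP.integral_eq (F := Prod.snd) fun i =>
    hP.integrable (continuous_snd.comp (continuous_Smap i))
  simp only [Fin.sum_univ_three, Smap, pr, Matrix.cons_val_zero, Matrix.cons_val_one,
    Matrix.cons_val] at h
  rw [integral_add (hi.div_const 2) (integrable_const _)] at h
  simp only [integral_div, integral_const, probReal_univ, one_smul] at h
  linarith

/-- The point `(1/2, √3/4)` is the mean of `P`, so the cross term vanishes. -/
lemma integral_sqDist_Smap (hP : IsRMeasure P) (i : Fin 3) (b : ℝ × ℝ) :
    ∫ x, sqDist (Smap i x) b ∂P = sr i ^ 2 * ∫ x, sqDist x (1 / 2, √3 / 4) ∂P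
      + sqDist (Smap i (1 / 2, √3 / 4)) b := by
  set a : ℝ × ℝ := (1 / 2, √3 / 4) with ha
  have z1 : ∫ x, (x.1 - a.1) ∂P = 0 := by
    rw [integral_sub (hP.integrable (by fun_prop)) (integrable_const _), hP.integral_fst]
    simp [ha]
  have z2 : ∫ x, (x.2 - a.2) ∂P = 0 := by
    rw [integral_sub (hP.integrable (by fun_prop)) (integrable_const _), hP.integral_snd]
    simp [ha]
  have key : ∀ x, sqDist (Smap i x) b = sr i ^ 2 * sqDist x a
      + 2 * sr i * ((Smap i a).1 - b.1) * (x.1 - a.1)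
      + 2 * sr i * ((Smap i a).2 - b.2) * (x.2 - a.2) + sqDist (Smap i a) b := by
    intro x
    fin_cases i <;> simp [Smap, sr, sqDist] <;> ring
  rw [integral_congr_ae (.of_forall key), integral_add, integral_add, integral_add]
  · simp only [integral_const_mul, z1, z2, integral_const, probReal_univ, one_smul]
    ring
  all_goals exact hP.integrable (by fun_prop)

lemma integral_sqDist_mean (hP : IsRMeasure P) :
    ∫ x, sqDist x (1 / 2, √3 / 4) ∂P = 27 / 176 := by
  have h3 : √3 ^ 2 = 3 := Real.sq_sqrt (by norm_num)
  have h := hP.integral_eq (F := fun x => sqDist x (1 / 2, √3 / 4)) fun i =>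
    hP.integrable ((continuous_sqDist _).comp (continuous_Smap i))
  rw [Fin.sum_univ_three, hP.integral_sqDist_Smap, hP.integral_sqDist_Smap,
    hP.integral_sqDist_Smap] at h
  simp only [Smap, pr, sr, Matrix.cons_val_zero, Matrix.cons_val_one, Matrix.cons_val] at h
  set V := ∫ x, sqDist x (1 / 2, √3 / 4) ∂P
  simp only [sqDist] at h
  ring_nf at h
  rw [h3] at h
  linarith

lemma E12_eq (hP : IsRMeasure P) (ω : List (Fin 3)) :
    E12 P ω = pw ω * sw ω ^ 2 * (2 / 5 * (27 / 176 / 16 + 9 / 64)) := by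
  have hΔ := isCompact_Δtri.measurableSet
  have hm : ∀ i, MeasurableSet (Smap i '' Δtri) := fun i =>
    (measurableEmbedding_Smap i).measurableSet_image.2 hΔ
  have hd : Disjoint (Smap 0 '' Δtri) (Smap 1 '' Δtri) := by
    rw [Set.disjoint_left]
    rintro _ ⟨x, hx, rfl⟩ ⟨y, hy, hyx⟩
    exact Smap_ne (by decide) hx hy hyx.symm
  rw [E12, a12, aw, aw, Sw_concat, Sw_concat, Function.comp_apply, Function.comp_apply,
    ← Sw_midpoint, image_comp, image_comp, ← image_union, hP.setIntegral_sqDist_Sw_image ω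
    (union_subset (Smap_image_subset 0 Subset.rfl) (Smap_image_subset 1 Subset.rfl))
    ((hm 0).union (hm 1)),
    setIntegral_union hd (hm 1) (hP.integrable (by fun_prop)).integrableOn
      (hP.integrable (by fun_prop)).integrableOn,
    hP.setIntegral_image 0 Subset.rfl hΔ, hP.setIntegral_image 1 Subset.rfl hΔ,
    hP.restrict_Δtri, hP.integral_sqDist_Smap, hP.integral_sqDist_Smap,
    hP.integral_sqDist_mean]
  congr 1
  simp [Smap, pr, sr, sqDist]
  ring

end IsRMeasure

/-- `E(ω1,ω2) = (47/18)·E(ω3) = (47/120)·E(ω)` and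
`E(ω1) = E(ω2) = (1/12)·E(ω3) = (1/80)·E(ω)`. -/
theorem stmt_15 (P : Measure (ℝ × ℝ)) [IsProbabilityMeasure P] (hP : IsRMeasure P)
    (ω : List (Fin 3)) :
    E12 P ω = (47/18) * Ew P (ω ++ [2]) ∧
    E12 P ω = (47/120) * Ew P ω ∧
    Ew P (ω ++ [0]) = Ew P (ω ++ [1]) ∧
    Ew P (ω ++ [0]) = (1/12) * Ew P (ω ++ [2]) ∧
    Ew P (ω ++ [0]) = (1/80) * Ew P ω := by
  have h0 := hP.Ew_concat ω 0
  have h1 := hP.Ew_concat ω 1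
  have h2 := hP.Ew_concat ω 2
  have hE := hP.Ew_eq ω
  have h12 := hP.E12_eq ω
  rw [hP.integral_sqDist_mean] at hE
  simp only [pr, sr, Matrix.cons_val_zero, Matrix.cons_val_one, Matrix.cons_val] at h0 h1 h2
  refine ⟨?_, ?_, ?_, ?_, ?_⟩ <;> linarith
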